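/- arXiv:2312.01533 — 2 statements merged into one kernel-verified Lean document; each statement's English description precedes it below -/
import Mathlib

section
/- Let Γ be a group and α, β : Γ → ℤ group homomorphisms, and suppose there is a 2-cycle (N; x_1,…,x_N; a_1,…,a_N; b_1,…,b_N) on Γ with Σ_{j=1}^N x_j·α(a_j)β(b_j) ≠ 0. Then there is no sequence of group homomorphisms ψ_n : Γ → U(n) such that ‖ψ_n(g) − ρ_n(g)‖_op → 0 as n → ∞ for every g ∈ Γ; that is, the asymptotic homomorphism (ρ_n) is not perturbable to genuine representations in the operator norm. -/
open Filter

/-- `ω_n = exp(2πi/n)`. -/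
noncomputable def voiOmega (n : ℕ) : ℂ :=
  Complex.exp (2 * Real.pi * Complex.I / n)

/-- The `n × n` Voiculescu cyclic-shift unitary `u_n`, whose `(i,j)` entry is `1`
when `i ≡ j + 1 (mod n)` and `0` otherwise. -/
noncomputable def voiU (n : ℕ) : Matrix (Fin n) (Fin n) ℂ :=
  Matrix.of fun i j => if (i : ℕ) = ((j : ℕ) + 1) % n then 1 else 0

/-- The `n × n` Voiculescu diagonal unitary `v_n`, whose `j`-th diagonal entry is
`ω_n ^ j` for `j = 1, …, n`. -/
noncomputable def voiV (n : ℕ) : Matrix (Fin n) (Fin n) ℂ :=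
  Matrix.diagonal fun j => voiOmega n ^ ((j : ℕ) + 1)

/-- Given homomorphisms `α, β : Γ → ℤ`, the map `ρ_n(g) = u_n ^ α(g) * v_n ^ β(g)`. -/
noncomputable def voiRho {Γ : Type*} [Group Γ] (α β : Γ → ℤ) (n : ℕ) (g : Γ) :
    Matrix (Fin n) (Fin n) ℂ :=
  voiU n ^ α g * voiV n ^ β g

/-- The data `(x_j, a_j, b_j)_{j=1}^N` is a 2-cycle on `Γ` when
`Σ_j x_j([a_j] − [a_j b_j] + [b_j]) = 0` in the free abelian group `ℤ[Γ]`. -/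
def IsTwoCycle {Γ : Type*} [Group Γ] {N : ℕ} (x : Fin N → ℤ) (a b : Fin N → Γ) : Prop :=
  ∑ j : Fin N,
    (Finsupp.single (a j) (x j) - Finsupp.single (a j * b j) (x j)
      + Finsupp.single (b j) (x j)) = (0 : Γ →₀ ℤ)

/-- The operator norm of an `n × n` complex matrix acting on the ℓ² space `ℂ^n`. -/
noncomputable def l2OpNorm {n : ℕ} (M : Matrix (Fin n) (Fin n) ℂ) : ℝ :=
  ‖LinearMap.toContinuousLinearMap (Matrix.toEuclideanLin M)‖

open scoped Matrix.Norms.L2Operator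

/-- A continuous path of logarithms of `1` starting at `0` ends at `0`. -/
theorem eq_zero_of_exp_path_eq_one {d : ℝ → ℂ} (hd : ContinuousOn d (Set.Icc 0 1))
    (hexp : ∀ t ∈ Set.Icc (0 : ℝ) 1, Complex.exp (d t) = 1) (h0 : d 0 = 0) : d 1 = 0 := by
  have h := Complex.isCoveringMap_exp.const_of_comp (A := Set.Icc (0 : ℝ) 1)
    (g := fun t => d t) (continuousOn_iff_continuous_domRestrict.mp hd)
    (fun s t => Subtype.ext ((hexp s s.2).trans (hexp t t.2).symm))
    ⟨1, by simp⟩ ⟨0, by simp⟩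
  exact h.trans h0

/-- `L` is a continuous logarithm of the determinant on the open unit ball around `1`. -/
structure IsLogDet {n : ℕ} (L : Matrix (Fin n) (Fin n) ℂ → ℂ) : Prop where
  continuousOn : ContinuousOn L (Metric.ball 1 1)
  exp_eq : ∀ X ∈ Metric.ball (1 : Matrix (Fin n) (Fin n) ℂ) 1, Complex.exp (L X) = X.det
  map_one : L 1 = 0

theorem exists_isLogDet (n : ℕ) : ∃ L : Matrix (Fin n) (Fin n) ℂ → ℂ, IsLogDet L := by
  let B := Metric.ball (1 : Matrix (Fin n) (Fin n) ℂ) 1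
  have : ContractibleSpace B := Metric.contractibleSpace_ball one_pos
  have : LocallyPathConnectedSpace B :=
    (convex_ball (1 : Matrix (Fin n) (Fin n) ℂ) 1).locallyPathConnectedSpace
  have h1 : (1 : Matrix (Fin n) (Fin n) ℂ) ∈ B := Metric.mem_ball_self one_pos
  have hdet : ∀ X : B, X.1.det ≠ 0 := fun X h => by
    refine nonunits.subset_compl_ball (a := X.1) ?_ X.2
    rw [mem_nonunits_iff, Matrix.isUnit_iff_isUnit_det, h]
    exact not_isUnit_zero
  obtain ⟨F, ⟨hF1, hF⟩, -⟩ := Complex.isCoveringMapOn_exp.existsUnique_continuousMap_lifts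
    (⟨fun X : B => X.1.det, Continuous.matrix_det continuous_subtype_val⟩ : C(B, ℂ))
    (a₀ := ⟨1, h1⟩) (e₀ := 0) (by simp) hdet
  classical
  refine ⟨fun X => if h : X ∈ B then F ⟨X, h⟩ else 0, ?_, fun X hX => ?_, ?_⟩
  · rw [continuousOn_iff_continuous_domRestrict]
    convert F.continuous using 1
    ext X
    simp [show X.1 ∈ B from X.2]
  · rw [dif_pos hX]
    exact congrFun hF ⟨X, hX⟩
  · rw [dif_pos h1, hF1]

theorem norm_lineMap_one_sub_one {n : ℕ} (X : Matrix (Fin n) (Fin n) ℂ) {t : ℝ}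
    (ht : t ∈ Set.Icc (0 : ℝ) 1) : ‖AffineMap.lineMap 1 X t - 1‖ ≤ ‖X - 1‖ := by
  rw [AffineMap.lineMap_apply_module', add_sub_cancel_right, norm_smul, Real.norm_of_nonneg ht.1]
  exact mul_le_of_le_one_left (norm_nonneg _) ht.2

theorem norm_mul_sub_one_le {n : ℕ} (X Y : Matrix (Fin n) (Fin n) ℂ) :
    ‖X * Y - 1‖ ≤ ‖X - 1‖ + ‖Y - 1‖ + ‖X - 1‖ * ‖Y - 1‖ := by
  calc ‖X * Y - 1‖ = ‖(X - 1) + (Y - 1) + (X - 1) * (Y - 1)‖ := by congr 1; noncomm_ring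
    _ ≤ _ := (norm_add_le _ _).trans (add_le_add (norm_add_le _ _) (norm_mul_le _ _))

namespace IsLogDet

variable {n : ℕ} {L : Matrix (Fin n) (Fin n) ℂ → ℂ}

theorem continuousOn_comp (hL : IsLogDet L) {γ : ℝ → Matrix (Fin n) (Fin n) ℂ}
    (hγ : Continuous γ) (hmem : ∀ t ∈ Set.Icc (0 : ℝ) 1, ‖γ t - 1‖ < 1) :
    ContinuousOn (fun t => L (γ t)) (Set.Icc 0 1) :=
  hL.continuousOn.comp hγ.continuousOn fun t ht => mem_ball_iff_norm.mpr (hmem t ht)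

theorem exp_eq' (hL : IsLogDet L) {X : Matrix (Fin n) (Fin n) ℂ} (hX : ‖X - 1‖ < 1) :
    Complex.exp (L X) = X.det :=
  hL.exp_eq X (mem_ball_iff_norm.mpr hX)

theorem map_mul (hL : IsLogDet L) {X Y : Matrix (Fin n) (Fin n) ℂ}
    (hX : ‖X - 1‖ < 1 / 3) (hY : ‖Y - 1‖ < 1 / 3) : L (X * Y) = L X + L Y := by
  let P : ℝ → Matrix (Fin n) (Fin n) ℂ := fun t => AffineMap.lineMap 1 X t
  let Q : ℝ → Matrix (Fin n) (Fin n) ℂ := fun t => AffineMap.lineMap 1 Y t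
  have hP : Continuous P := AffineMap.lineMap_continuous
  have hQ : Continuous Q := AffineMap.lineMap_continuous
  have hP3 : ∀ t ∈ Set.Icc (0 : ℝ) 1, ‖P t - 1‖ < 1 / 3 := fun t ht =>
    (norm_lineMap_one_sub_one X ht).trans_lt hX
  have hQ3 : ∀ t ∈ Set.Icc (0 : ℝ) 1, ‖Q t - 1‖ < 1 / 3 := fun t ht =>
    (norm_lineMap_one_sub_one Y ht).trans_lt hY
  have hP1 : ∀ t ∈ Set.Icc (0 : ℝ) 1, ‖P t - 1‖ < 1 := fun t ht => by linarith [hP3 t ht]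
  have hQ1 : ∀ t ∈ Set.Icc (0 : ℝ) 1, ‖Q t - 1‖ < 1 := fun t ht => by linarith [hQ3 t ht]
  have hPQ1 : ∀ t ∈ Set.Icc (0 : ℝ) 1, ‖P t * Q t - 1‖ < 1 := fun t ht => by
    have := norm_mul_sub_one_le (P t) (Q t)
    nlinarith [hP3 t ht, hQ3 t ht, norm_nonneg (P t - 1), norm_nonneg (Q t - 1)]
  have key := eq_zero_of_exp_path_eq_one
    (d := fun t => L (P t * Q t) - (L (P t) + L (Q t)))
    ((hL.continuousOn_comp (hP.mul hQ) hPQ1).sub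
      ((hL.continuousOn_comp hP hP1).add (hL.continuousOn_comp hQ hQ1)))
    (fun t ht => by
      rw [Complex.exp_sub, Complex.exp_add, hL.exp_eq' (hPQ1 t ht), Matrix.det_mul,
        ← hL.exp_eq' (hP1 t ht), ← hL.exp_eq' (hQ1 t ht)]
      exact div_self (mul_ne_zero (Complex.exp_ne_zero _) (Complex.exp_ne_zero _)))
    (by simp [P, Q, hL.map_one])
  simpa [P, Q, sub_eq_zero] using key

theorem map_conj (hL : IsLogDet L) (R : Matrix.unitaryGroup (Fin n) ℂ)
    {X : Matrix (Fin n) (Fin n) ℂ} (hX : ‖X - 1‖ < 1) :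
    L (R * X * (R⁻¹ : Matrix.unitaryGroup (Fin n) ℂ)) = L X := by
  let P : ℝ → Matrix (Fin n) (Fin n) ℂ := fun t => AffineMap.lineMap 1 X t
  have hP : Continuous P := AffineMap.lineMap_continuous
  have hRR : (R : Matrix (Fin n) (Fin n) ℂ) * (R⁻¹ : Matrix.unitaryGroup (Fin n) ℂ) = 1 :=
    congrArg Subtype.val (mul_inv_cancel R)
  have hP1 : ∀ t ∈ Set.Icc (0 : ℝ) 1, ‖P t - 1‖ < 1 := fun t ht =>
    (norm_lineMap_one_sub_one X ht).trans_lt hX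
  have hQ1 : ∀ t ∈ Set.Icc (0 : ℝ) 1,
      ‖R * P t * (R⁻¹ : Matrix.unitaryGroup (Fin n) ℂ) - 1‖ < 1 := fun t ht => by
    have : R * P t * (R⁻¹ : Matrix.unitaryGroup (Fin n) ℂ) - 1
        = R * (P t - 1) * (R⁻¹ : Matrix.unitaryGroup (Fin n) ℂ) := by
      rw [mul_sub, sub_mul, mul_one, hRR]
    rw [this, CStarRing.norm_mul_coe_unitary, CStarRing.norm_coe_unitary_mul]
    exact hP1 t ht
  have key := eq_zero_of_exp_path_eq_one
    (d := fun t => L (R * P t * (R⁻¹ : Matrix.unitaryGroup (Fin n) ℂ)) - L (P t))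
    ((hL.continuousOn_comp ((continuous_const.mul hP).mul continuous_const) hQ1).sub
      (hL.continuousOn_comp hP hP1))
    (fun t ht => by
      have hdet := congrArg Matrix.det hRR
      rw [Matrix.det_mul, Matrix.det_one] at hdet
      rw [Complex.exp_sub, hL.exp_eq' (hQ1 t ht), Matrix.det_mul, Matrix.det_mul, mul_right_comm,
        hdet, one_mul, ← hL.exp_eq' (hP1 t ht)]
      exact div_self (Complex.exp_ne_zero _))
    (by simp only [P, AffineMap.lineMap_apply_zero, mul_one, hRR, sub_self])
  simpa only [P, AffineMap.lineMap_apply_one, sub_eq_zero] using key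

end IsLogDet

theorem norm_exp_smul_one_sub_one_le {n : ℕ} [NeZero n] (θ : ℝ) :
    ‖Complex.exp (Complex.I * θ) • (1 : Matrix (Fin n) (Fin n) ℂ) - 1‖ ≤ |θ| := by
  have h : Complex.exp (Complex.I * θ) • (1 : Matrix (Fin n) (Fin n) ℂ) - 1
      = (Complex.exp (Complex.I * θ) - 1) • (1 : Matrix (Fin n) (Fin n) ℂ) := by
    rw [sub_smul, one_smul]
  rw [h, norm_smul, CStarRing.norm_one, mul_one]
  exact Real.norm_exp_I_mul_ofReal_sub_one_le

theorem IsLogDet.map_exp_smul_one {n : ℕ} [NeZero n] {L : Matrix (Fin n) (Fin n) ℂ → ℂ}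
    (hL : IsLogDet L) {θ : ℝ} (hθ : |θ| < 1) :
    L (Complex.exp (Complex.I * θ) • 1) = n * (Complex.I * θ) := by
  let P : ℝ → Matrix (Fin n) (Fin n) ℂ := fun t =>
    Complex.exp (Complex.I * (t * θ : ℝ)) • 1
  have hP : Continuous P := by fun_prop
  have hP1 : ∀ t ∈ Set.Icc (0 : ℝ) 1, ‖P t - 1‖ < 1 := fun t ht => by
    refine (norm_exp_smul_one_sub_one_le (t * θ)).trans_lt ?_
    rw [abs_mul, abs_of_nonneg ht.1]
    exact (mul_le_of_le_one_left (abs_nonneg _) ht.2).trans_lt hθ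
  have key := eq_zero_of_exp_path_eq_one
    (d := fun t => L (P t) - n * (Complex.I * (t * θ : ℝ)))
    ((hL.continuousOn_comp hP hP1).sub (by fun_prop))
    (fun t ht => by
      rw [Complex.exp_sub, hL.exp_eq' (hP1 t ht), Matrix.det_smul, Matrix.det_one, mul_one,
        Fintype.card_fin, Complex.exp_nat_mul]
      exact div_self (pow_ne_zero _ (Complex.exp_ne_zero _)))
    (by simp [P, hL.map_one])
  simpa [P, sub_eq_zero] using key

theorem voiU_eq (n : ℕ) [NeZero n] :
    voiU n = Matrix.of fun i j : Fin n =>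
      if i = ⟨((j : ℕ) + 1) % n, Nat.mod_lt _ (NeZero.pos n)⟩ then 1 else 0 := by
  ext i j
  simp [voiU, Fin.ext_iff]

theorem voiU_mem_unitaryGroup (n : ℕ) [NeZero n] : voiU n ∈ Matrix.unitaryGroup (Fin n) ℂ := by
  rw [Matrix.mem_unitaryGroup_iff', voiU_eq]
  ext i j
  have h : ((j : ℕ) + 1) % n = ((i : ℕ) + 1) % n ↔ i = j := by
    refine ⟨fun h => Fin.ext ?_, fun h => by rw [h]⟩
    exact (Nat.ModEq.eq_of_lt_of_lt (Nat.ModEq.add_right_cancel' 1 h) j.2 i.2).symm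
  simp [Matrix.mul_apply, Matrix.star_apply, Matrix.one_apply, h]

theorem voiOmega_zpow (n : ℕ) (k : ℤ) :
    voiOmega n ^ k = Complex.exp (Complex.I * (2 * Real.pi * k / n : ℝ)) := by
  rw [voiOmega, ← Complex.exp_int_mul]
  congr 1
  push_cast
  ring

theorem voiOmega_pow_self (n : ℕ) [NeZero n] : voiOmega n ^ n = 1 := by
  have hn : (n : ℂ) ≠ 0 := Nat.cast_ne_zero.mpr (NeZero.ne n)
  rw [voiOmega, ← Complex.exp_nat_mul, mul_div_cancel₀ _ hn, Complex.exp_two_pi_mul_I]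

theorem star_voiOmega_mul_self (n : ℕ) : star (voiOmega n) * voiOmega n = 1 := by
  have h := voiOmega_zpow n 1
  rw [zpow_one] at h
  rw [h, Complex.star_def, ← Complex.normSq_eq_conj_mul_self, Complex.normSq_eq_norm_sq,
    Complex.norm_exp_I_mul_ofReal]
  simp

theorem voiV_mem_unitaryGroup (n : ℕ) : voiV n ∈ Matrix.unitaryGroup (Fin n) ℂ := by
  rw [Matrix.mem_unitaryGroup_iff', voiV, Matrix.star_eq_conjTranspose,
    Matrix.diagonal_conjTranspose, Matrix.diagonal_mul_diagonal, ← Matrix.diagonal_one]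
  congr 1
  ext j
  rw [Pi.star_apply, star_pow, ← mul_pow, star_voiOmega_mul_self, one_pow]

theorem voiOmega_smul_one_mem_unitaryGroup (n : ℕ) :
    voiOmega n • (1 : Matrix (Fin n) (Fin n) ℂ) ∈ Matrix.unitaryGroup (Fin n) ℂ := by
  rw [Matrix.mem_unitaryGroup_iff', star_smul, star_one, smul_mul_smul, star_voiOmega_mul_self,
    one_mul, one_smul]

theorem voiV_mul_voiU (n : ℕ) [NeZero n] : voiV n * voiU n = voiOmega n • (voiU n * voiV n) := by
  ext i j
  rw [voiV, Matrix.diagonal_mul, Matrix.smul_apply, Matrix.mul_diagonal, smul_eq_mul]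
  by_cases h : (i : ℕ) = ((j : ℕ) + 1) % n
  · have hpow : voiOmega n ^ (i : ℕ) = voiOmega n ^ ((j : ℕ) + 1) := by
      rw [h, ← pow_eq_pow_mod _ (voiOmega_pow_self n)]
    rw [pow_succ, hpow]
    ring
  · simp [voiU, h]

/-- If the commutator `w` of `v` and `u` is central, then
`v ^ m * u ^ k = w ^ (m * k) * (u ^ k * v ^ m)`. -/
theorem zpow_mul_zpow_of_central {G : Type*} [Group G] {u v w : G} (hw : ∀ g, Commute w g)
    (h : v * u = w * (u * v)) (m k : ℤ) : v ^ m * u ^ k = w ^ (m * k) * (u ^ k * v ^ m) := by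
  have h1 : SemiconjBy v (u ^ k) (w ^ k * u ^ k) := by
    rw [← (hw u).mul_zpow]
    exact SemiconjBy.zpow_right (h.trans (mul_assoc _ _ _).symm) k
  have h2 : SemiconjBy (u ^ k) (w ^ k * v) v := by
    rw [SemiconjBy, ← mul_assoc, ← ((hw (u ^ k)).zpow_left k).eq]
    exact h1.eq.symm
  have h3 := (h2.zpow_right m).eq
  rw [((hw v).zpow_left k).mul_zpow, ← zpow_mul, mul_comm k m, ← mul_assoc,
    ← ((hw (u ^ k)).zpow_left (m * k)).eq, mul_assoc] at h3
  exact h3.symm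

/-- A 2-cycle annihilates every coboundary. -/
theorem IsTwoCycle.sum_coboundary_eq_zero {Γ A : Type*} [Group Γ] [AddCommGroup A] {N : ℕ}
    {x : Fin N → ℤ} {a b : Fin N → Γ} (h : IsTwoCycle x a b) (f : Γ → A) :
    ∑ j, x j • (f (a j) - f (a j * b j) + f (b j)) = 0 := by
  have := congrArg (Finsupp.liftAddHom fun g => (smulAddHom ℤ A).flip (f g)) h
  simpa only [map_sum, map_add, map_sub, Finsupp.liftAddHom_apply_single, AddMonoidHom.flip_apply,
    smulAddHom_apply, map_zero, ← smul_sub, ← smul_add] using this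

/-- The matrix `u_n` as an element of the unitary group. -/
noncomputable def voiUnitaryU (n : ℕ) [NeZero n] : Matrix.unitaryGroup (Fin n) ℂ :=
  ⟨voiU n, voiU_mem_unitaryGroup n⟩

/-- The matrix `v_n` as an element of the unitary group. -/
noncomputable def voiUnitaryV (n : ℕ) : Matrix.unitaryGroup (Fin n) ℂ :=
  ⟨voiV n, voiV_mem_unitaryGroup n⟩

/-- The scalar matrix `ω_n` as an element of the unitary group. -/
noncomputable def voiUnitaryOmega (n : ℕ) : Matrix.unitaryGroup (Fin n) ℂ :=
  ⟨voiOmega n • 1, voiOmega_smul_one_mem_unitaryGroup n⟩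

theorem coe_unitaryGroup_zpow {n : ℕ} (U : Matrix.unitaryGroup (Fin n) ℂ) (k : ℤ) :
    ((U ^ k : Matrix.unitaryGroup (Fin n) ℂ) : Matrix (Fin n) (Fin n) ℂ)
      = (U : Matrix (Fin n) (Fin n) ℂ) ^ k := by
  have h : ∀ W : Matrix.unitaryGroup (Fin n) ℂ,
      (W : Matrix (Fin n) (Fin n) ℂ) = (Unitary.toUnits W : (Matrix (Fin n) (Fin n) ℂ)ˣ) :=
    fun _ => rfl
  rw [h, map_zpow, Matrix.coe_units_zpow, h]

theorem commute_voiUnitaryOmega (n : ℕ) (g : Matrix.unitaryGroup (Fin n) ℂ) :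
    Commute (voiUnitaryOmega n) g :=
  Subtype.ext (by simp [voiUnitaryOmega])

theorem coe_voiUnitaryOmega_zpow (n : ℕ) (k : ℤ) :
    ((voiUnitaryOmega n ^ k : Matrix.unitaryGroup (Fin n) ℂ) : Matrix (Fin n) (Fin n) ℂ)
      = Complex.exp (Complex.I * (2 * Real.pi * k / n : ℝ)) • 1 := by
  have hω : voiOmega n ≠ 0 := Complex.exp_ne_zero _
  rw [← voiOmega_zpow, coe_unitaryGroup_zpow, voiUnitaryOmega]
  obtain ⟨m, rfl | rfl⟩ := k.eq_nat_or_neg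
  · simp [smul_pow]
  · rw [Matrix.zpow_neg_natCast, smul_pow, one_pow, zpow_neg, zpow_natCast]
    refine Matrix.inv_eq_right_inv ?_
    rw [smul_mul_smul, mul_inv_cancel₀ (pow_ne_zero m hω), one_mul, one_smul]

/-- The map `ρ_n` with values in the unitary group. -/
noncomputable def voiUnitaryRho {Γ : Type*} (α β : Γ → ℤ) (n : ℕ) [NeZero n] (g : Γ) :
    Matrix.unitaryGroup (Fin n) ℂ :=
  voiUnitaryU n ^ α g * voiUnitaryV n ^ β g

theorem coe_voiUnitaryRho {Γ : Type*} [Group Γ] (α β : Γ → ℤ) (n : ℕ) [NeZero n] (g : Γ) :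
    (voiUnitaryRho α β n g : Matrix (Fin n) (Fin n) ℂ) = voiRho α β n g := by
  rw [voiUnitaryRho, Submonoid.coe_mul, coe_unitaryGroup_zpow, coe_unitaryGroup_zpow]
  rfl

theorem voiUnitaryRho_mul {Γ : Type*} [Group Γ] {α β : Γ → ℤ}
    (hα : ∀ g h : Γ, α (g * h) = α g + α h) (hβ : ∀ g h : Γ, β (g * h) = β g + β h)
    (n : ℕ) [NeZero n] (g h : Γ) :
    voiUnitaryRho α β n g * voiUnitaryRho α β n h
      = voiUnitaryOmega n ^ (β g * α h) * voiUnitaryRho α β n (g * h) := by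
  have hw := commute_voiUnitaryOmega n
  have hvu : voiUnitaryV n * voiUnitaryU n
      = voiUnitaryOmega n * (voiUnitaryU n * voiUnitaryV n) :=
    Subtype.ext (by simpa [voiUnitaryV, voiUnitaryU, voiUnitaryOmega] using voiV_mul_voiU n)
  have key := zpow_mul_zpow_of_central hw hvu (β g) (α h)
  have hc := ((hw (voiUnitaryU n ^ α g)).zpow_left (β g * α h)).eq
  simp only [voiUnitaryRho, hα, hβ, zpow_add]
  calc voiUnitaryU n ^ α g * voiUnitaryV n ^ β g * (voiUnitaryU n ^ α h * voiUnitaryV n ^ β h)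
      = voiUnitaryU n ^ α g * (voiUnitaryV n ^ β g * voiUnitaryU n ^ α h)
          * voiUnitaryV n ^ β h := by group
    _ = (voiUnitaryU n ^ α g * voiUnitaryOmega n ^ (β g * α h))
          * (voiUnitaryU n ^ α h * voiUnitaryV n ^ β g) * voiUnitaryV n ^ β h := by
        rw [key]; group
    _ = _ := by rw [← hc]; group

/-- For a unitary representation `ψ` close to `ρ_n`, the logarithm of the determinant of
`ψ(g) ρ_n(g)⁻¹` has coboundary `2πi β(g) α(h)`. -/
theorem IsLogDet.map_mul_inv_voiUnitaryRho {Γ : Type*} [Group Γ] {α β : Γ → ℤ}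
    (hα : ∀ g h : Γ, α (g * h) = α g + α h) (hβ : ∀ g h : Γ, β (g * h) = β g + β h)
    {n : ℕ} [NeZero n] {L : Matrix (Fin n) (Fin n) ℂ → ℂ} (hL : IsLogDet L)
    (ψ : Γ →* Matrix.unitaryGroup (Fin n) ℂ) {g h : Γ}
    (hg : ‖(ψ g : Matrix (Fin n) (Fin n) ℂ) - voiRho α β n g‖ < 1 / 9)
    (hh : ‖(ψ h : Matrix (Fin n) (Fin n) ℂ) - voiRho α β n h‖ < 1 / 9)
    (hn : |2 * Real.pi * (β g * α h : ℤ) / n| < 1 / 3) :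
    L ↑(ψ (g * h) * (voiUnitaryRho α β n (g * h))⁻¹)
      = L ↑(ψ g * (voiUnitaryRho α β n g)⁻¹) + L ↑(ψ h * (voiUnitaryRho α β n h)⁻¹)
        + 2 * Real.pi * Complex.I * (β g * α h : ℤ) := by
  set R := voiUnitaryRho α β n with hR
  have hnorm : ∀ k : Γ, ‖((ψ k * (R k)⁻¹ : Matrix.unitaryGroup (Fin n) ℂ) :
      Matrix (Fin n) (Fin n) ℂ) - 1‖ = ‖(ψ k : Matrix (Fin n) (Fin n) ℂ) - voiRho α β n k‖ :=
    fun k => by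
      have hRR : (R k : Matrix (Fin n) (Fin n) ℂ) * ((R k)⁻¹ : Matrix.unitaryGroup (Fin n) ℂ) = 1 :=
        congrArg Subtype.val (mul_inv_cancel (R k))
      rw [← coe_voiUnitaryRho, ← CStarRing.norm_mul_coe_unitary ((ψ k : Matrix (Fin n) (Fin n) ℂ) - _) (R k)⁻¹, sub_mul, ← hR, hRR]
      rfl
  have hprod : ψ (g * h) * (R (g * h))⁻¹
      = (ψ g * (R g)⁻¹) * (R g * (ψ h * (R h)⁻¹) * (R g)⁻¹) * voiUnitaryOmega n ^ (β g * α h) := by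
    have h1 : R (g * h) = (voiUnitaryOmega n ^ (β g * α h))⁻¹ * (R g * R h) := by
      rw [hR, voiUnitaryRho_mul hα hβ, inv_mul_cancel_left]
    rw [h1, _root_.map_mul]
    group
  have hconj : ‖((R g * (ψ h * (R h)⁻¹) * (R g)⁻¹ : Matrix.unitaryGroup (Fin n) ℂ) :
      Matrix (Fin n) (Fin n) ℂ) - 1‖ < 1 / 9 := by
    have hRR : (R g : Matrix (Fin n) (Fin n) ℂ) * ((R g)⁻¹ : Matrix.unitaryGroup (Fin n) ℂ) = 1 :=
      congrArg Subtype.val (mul_inv_cancel (R g))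
    rw [← hnorm, ← CStarRing.norm_coe_unitary_mul (R g),
      ← CStarRing.norm_mul_coe_unitary _ (R g)⁻¹, mul_sub, sub_mul, mul_one, hRR] at hh
    exact hh
  have hg' := (hnorm g).trans_lt hg
  have hh' := (hnorm h).trans_lt hh
  have hω : ‖((voiUnitaryOmega n ^ (β g * α h) : Matrix.unitaryGroup (Fin n) ℂ) :
      Matrix (Fin n) (Fin n) ℂ) - 1‖ < 1 / 3 := by
    rw [coe_voiUnitaryOmega_zpow]
    exact (norm_exp_smul_one_sub_one_le _).trans_lt hn
  have hLconj : L ↑(R g * (ψ h * (R h)⁻¹) * (R g)⁻¹) = L ↑(ψ h * (R h)⁻¹) :=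
    hL.map_conj (R g) (by linarith)
  rw [hprod, Submonoid.coe_mul, hL.map_mul ?_ hω, Submonoid.coe_mul, hL.map_mul (by linarith)
    (by linarith), hLconj, coe_voiUnitaryOmega_zpow, hL.map_exp_smul_one (by linarith)]
  · have hn0 : (n : ℂ) ≠ 0 := Nat.cast_ne_zero.mpr (NeZero.ne n)
    push_cast
    field_simp
  · rw [Submonoid.coe_mul]
    refine (norm_mul_sub_one_le _ _).trans_lt ?_
    nlinarith [norm_nonneg (((ψ g * (R g)⁻¹ : Matrix.unitaryGroup (Fin n) ℂ) :
      Matrix (Fin n) (Fin n) ℂ) - 1), norm_nonneg (((R g * (ψ h * (R h)⁻¹) * (R g)⁻¹ :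
      Matrix.unitaryGroup (Fin n) ℂ) : Matrix (Fin n) (Fin n) ℂ) - 1)]

/-- If the cocycle `(g,h) ↦ α(g)β(h)` pairs nontrivially with some 2-cycle, then the
asymptotic homomorphism `(ρ_n)` is not perturbable to genuine unitary representations
in the operator norm. -/
theorem voiRho_not_perturbable_opNorm {Γ : Type*} [Group Γ] (α β : Γ → ℤ)
    (hα : ∀ g h : Γ, α (g * h) = α g + α h) (hβ : ∀ g h : Γ, β (g * h) = β g + β h)
    (N : ℕ) (x : Fin N → ℤ) (a b : Fin N → Γ) (hcycle : IsTwoCycle x a b)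
    (hpair : ∑ j : Fin N, x j * (α (a j) * β (b j)) ≠ 0) :
    ¬ ∃ ψ : ∀ n : ℕ, Γ →* Matrix.unitaryGroup (Fin n) ℂ,
        ∀ g : Γ,
          Tendsto
            (fun n : ℕ =>
              l2OpNorm ((ψ n g : Matrix (Fin n) (Fin n) ℂ) - voiRho α β n g))
            atTop (nhds 0) := by

  rintro ⟨ψ, hψ⟩
  have hclose : ∀ᶠ n in atTop, ∀ j : Fin N,
      l2OpNorm ((ψ n (a j) : Matrix (Fin n) (Fin n) ℂ) - voiRho α β n (a j)) < 1 / 9 ∧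
      l2OpNorm ((ψ n (b j) : Matrix (Fin n) (Fin n) ℂ) - voiRho α β n (b j)) < 1 / 9 ∧
      |2 * Real.pi * (β (a j) * α (b j) : ℤ) / n| < 1 / 3 := by
    refine eventually_all.mpr fun j => ?_
    have h0 : (0 : ℝ) < 1 / 9 := by norm_num
    have hdiv := (tendsto_const_div_atTop_nhds_zero_nat
      (2 * Real.pi * (β (a j) * α (b j) : ℤ))).abs
    rw [abs_zero] at hdiv
    exact ((hψ (a j)).eventually_lt_const h0).and
      (((hψ (b j)).eventually_lt_const h0).and (hdiv.eventually_lt_const (by norm_num)))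
  obtain ⟨n, hn, hn0⟩ := (hclose.and (eventually_gt_atTop 0)).exists
  have : NeZero n := ⟨hn0.ne'⟩
  obtain ⟨L, hL⟩ := exists_isLogDet n
  have hzero : (∑ j, x j * (β (a j) * α (b j))) = 0 := by
    have hsum := hcycle.sum_coboundary_eq_zero
      fun g => L ↑(ψ n g * (voiUnitaryRho α β n g)⁻¹)
    have hterm : ∀ j, x j • (L ↑(ψ n (a j) * (voiUnitaryRho α β n (a j))⁻¹)
        - L ↑(ψ n (a j * b j) * (voiUnitaryRho α β n (a j * b j))⁻¹)
        + L ↑(ψ n (b j) * (voiUnitaryRho α β n (b j))⁻¹))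
        = -(2 * Real.pi * Complex.I) * (x j * (β (a j) * α (b j)) : ℤ) := fun j => by
      obtain ⟨h1, h2, h3⟩ := hn j
      rw [hL.map_mul_inv_voiUnitaryRho hα hβ (ψ n) h1 h2 h3, zsmul_eq_mul]
      push_cast
      ring
    rw [Finset.sum_congr rfl fun j _ => hterm j, ← Finset.mul_sum] at hsum
    exact_mod_cast (mul_eq_zero.mp hsum).resolve_left
      (neg_ne_zero.mpr Complex.two_pi_I_ne_zero)
  have hsymm := hcycle.sum_coboundary_eq_zero fun g => α g * β g
  refine hpair ?_
  calc ∑ j, x j * (α (a j) * β (b j))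
      = -(∑ j, x j • (α (a j) * β (a j) - α (a j * b j) * β (a j * b j) + α (b j) * β (b j)))
        - ∑ j, x j * (β (a j) * α (b j)) := by
        rw [← Finset.sum_neg_distrib, ← Finset.sum_sub_distrib]
        refine Finset.sum_congr rfl fun j _ => ?_
        rw [hα, hβ, smul_eq_mul]
        ring
    _ = 0 := by rw [hsymm, hzero]; rfl
end

section
/- Let Γ be a group and α, β : Γ → ℤ group homomorphisms, and suppose there is a 2-cycle (N; x_1,…,x_N; a_1,…,a_N; b_1,…,b_N) on Γ with Σ_{j=1}^N x_j·α(a_j)β(b_j) ≠ 0. Then Γ is not matricially stable: there exists a sequence of maps φ_n : Γ → U(n) into the n×n complex unitary matrices with ‖φ_n(gh) − φ_n(g)φ_n(h)‖_op → 0 as n → ∞ for all g, h ∈ Γ, such that no sequence of group homomorphisms ψ_n : Γ → U(n) satisfies ‖ψ_n(g) − φ_n(g)‖_op → 0 for all g ∈ Γ. -/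
open Filter

section MatrixLogarithm

open scoped Matrix.Norms.L2Operator
open selfAdjoint Unitary

section Determinant

variable {n : ℕ}

/-- The real part of the trace of a selfadjoint matrix. -/
noncomputable def reTrace (x : selfAdjoint (Matrix (Fin n) (Fin n) ℂ)) : ℝ :=
  (Matrix.trace (x : Matrix (Fin n) (Fin n) ℂ)).re

lemma continuous_reTrace :
    Continuous (reTrace : selfAdjoint (Matrix (Fin n) (Fin n) ℂ) → ℝ) :=
  Complex.continuous_re.comp continuous_subtype_val.matrix_trace

lemma reTrace_smul (t : ℝ) (x : selfAdjoint (Matrix (Fin n) (Fin n) ℂ)) :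
    reTrace (t • x) = t * reTrace x := by
  simp [reTrace]

lemma det_expUnitary (x : selfAdjoint (Matrix (Fin n) (Fin n) ℂ)) :
    Matrix.det (expUnitary x : Matrix (Fin n) (Fin n) ℂ)
      = Complex.exp (Complex.I * (reTrace x : ℂ)) := by
  have hx : Matrix.IsHermitian (x : Matrix (Fin n) (Fin n) ℂ) := x.2
  have hunit : IsUnit (hx.eigenvectorUnitary : Matrix (Fin n) (Fin n) ℂ) :=
    (Unitary.toUnits hx.eigenvectorUnitary).isUnit
  have hexp : (expUnitary x : Matrix (Fin n) (Fin n) ℂ)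
      = hx.eigenvectorUnitary
        * Matrix.diagonal (fun i => Complex.exp (Complex.I * (hx.eigenvalues i : ℂ)))
        * (hx.eigenvectorUnitary : Matrix (Fin n) (Fin n) ℂ)⁻¹ := by
    have hinv : (star hx.eigenvectorUnitary : Matrix (Fin n) (Fin n) ℂ)
        = (hx.eigenvectorUnitary : Matrix (Fin n) (Fin n) ℂ)⁻¹ :=
      (Matrix.inv_eq_right_inv (Unitary.coe_mul_star_self _)).symm
    have hI : Complex.I • (x : Matrix (Fin n) (Fin n) ℂ)
        = hx.eigenvectorUnitary
          * Matrix.diagonal (fun i => Complex.I * (hx.eigenvalues i : ℂ))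
          * (hx.eigenvectorUnitary : Matrix (Fin n) (Fin n) ℂ)⁻¹ := by
      conv_lhs => rw [hx.spectral_theorem, Unitary.conjStarAlgAut_apply, ← Matrix.smul_mul,
        ← Matrix.mul_smul, ← Matrix.diagonal_smul, hinv]
      rfl
    rw [expUnitary_coe, hI, Matrix.exp_conj _ _ hunit,
      Matrix.exp_diagonal]
    congr 3
    ext i
    simp [Pi.coe_exp, Complex.exp_eq_exp_ℂ]
  rw [hexp, Matrix.det_conj hunit, Matrix.det_diagonal,
    ← Complex.exp_sum, ← Finset.mul_sum, reTrace, hx.trace_eq_sum_eigenvalues]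
  simp

lemma exists_int_of_det_eq {u : Matrix.unitaryGroup (Fin n) ℂ}
    (hu : ‖(u - 1 : Matrix (Fin n) (Fin n) ℂ)‖ < 2) {s : ℝ}
    (hdet : Matrix.det (u : Matrix (Fin n) (Fin n) ℂ) = Complex.exp (Complex.I * (s : ℂ))) :
    ∃ k : ℤ, reTrace (argSelfAdjoint u) - s = k * (2 * Real.pi) := by
  have h := det_expUnitary (argSelfAdjoint u)
  rw [expUnitary_argSelfAdjoint hu, hdet, Complex.exp_eq_exp_iff_exists_int] at h
  obtain ⟨k, hk⟩ := h
  refine ⟨-k, ?_⟩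
  have h2 : (s : ℂ) = reTrace (argSelfAdjoint u) + k * (2 * Real.pi) :=
    mul_left_cancel₀ Complex.I_ne_zero (by rw [hk]; ring)
  have h3 : s = reTrace (argSelfAdjoint u) + k * (2 * Real.pi) := by exact_mod_cast h2
  push_cast
  linarith

/-- A continuous path of unitaries at distance less than `2` from `1`, starting at `1`, has
logarithms whose traces follow the continuous branch of the argument of the determinant. -/
lemma reTrace_argSelfAdjoint_path (w : ℝ → Matrix.unitaryGroup (Fin n) ℂ) (hw : Continuous w)
    (hnorm : ∀ t ∈ Set.Icc (0 : ℝ) 1, ‖(w t - 1 : Matrix (Fin n) (Fin n) ℂ)‖ < 2)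
    (h0 : w 0 = 1) (s : ℝ)
    (hdet : ∀ t : ℝ, Matrix.det (w t : Matrix (Fin n) (Fin n) ℂ)
      = Complex.exp (Complex.I * ((t * s : ℝ) : ℂ))) :
    reTrace (argSelfAdjoint (w 1)) = s := by
  set f : ℝ → ℝ := fun t => (reTrace (argSelfAdjoint (w t)) - t * s) / (2 * Real.pi) with hf
  have hcont : ContinuousOn f (Set.Icc 0 1) := by
    refine ContinuousOn.div_const (ContinuousOn.sub ?_ (by fun_prop)) _
    refine continuous_reTrace.comp_continuousOn ?_
    refine Unitary.continuousOn_argSelfAdjoint.comp hw.continuousOn fun t ht => ?_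
    simpa [Subtype.dist_eq, dist_eq_norm] using hnorm t ht
  have hmaps : Set.MapsTo f (Set.Icc 0 1) (Set.range ((↑) : ℤ → ℝ)) := by
    intro t ht
    obtain ⟨k, hk⟩ := exists_int_of_det_eq (hnorm t ht) (hdet t)
    refine ⟨k, ?_⟩
    rw [hf]
    simp only [hk]
    field_simp
  have hdisc : IsDiscrete (Set.range ((↑) : ℤ → ℝ)) :=
    ⟨Int.isClosedEmbedding_coe_real.isEmbedding.toHomeomorph.symm.isEmbedding.discreteTopology⟩
  have h := isPreconnected_Icc.constant_of_mapsTo hdisc hcont hmaps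
    (Set.right_mem_Icc.2 zero_le_one) (Set.left_mem_Icc.2 zero_le_one)
  have harg : argSelfAdjoint (1 : Matrix.unitaryGroup (Fin n) ℂ) = 0 := by
    rw [← expUnitary_zero, argSelfAdjoint_expUnitary (by simpa using Real.pi_pos)]
  simp only [hf, h0, harg] at h
  have hz : reTrace (0 : selfAdjoint (Matrix (Fin n) (Fin n) ℂ)) = 0 := by simp [reTrace]
  rw [hz] at h
  have hpi := Real.pi_pos
  field_simp at h
  linarith

lemma reTrace_argSelfAdjoint_defect (p q : Matrix.unitaryGroup (Fin n) ℂ)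
    (x y z : selfAdjoint (Matrix (Fin n) (Fin n) ℂ))
    (hx : ∀ t ∈ Set.Icc (0 : ℝ) 1,
      ‖(expUnitary (t • x) - 1 : Matrix (Fin n) (Fin n) ℂ)‖ < 1 / 2)
    (hy : ∀ t ∈ Set.Icc (0 : ℝ) 1,
      ‖(expUnitary (t • y) - 1 : Matrix (Fin n) (Fin n) ℂ)‖ < 1 / 2)
    (hz : ∀ t ∈ Set.Icc (0 : ℝ) 1,
      ‖(expUnitary (t • z) - 1 : Matrix (Fin n) (Fin n) ℂ)‖ < 1 / 2) :
    reTrace (argSelfAdjoint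
      (p * expUnitary x * (q * expUnitary y) * star (p * q * expUnitary z)))
      = reTrace x + reTrace y - reTrace z := by
  set w : ℝ → Matrix.unitaryGroup (Fin n) ℂ := fun t =>
    p * expUnitary (t • x) * (q * expUnitary (t • y)) * star (p * q * expUnitary (t • z)) with hw
  have hdetne (u : Matrix.unitaryGroup (Fin n) ℂ) :
      Matrix.det (u : Matrix (Fin n) (Fin n) ℂ) ≠ 0 :=
    ((Matrix.isUnit_iff_isUnit_det _).1 (Unitary.toUnits u).isUnit).ne_zero
  have h := reTrace_argSelfAdjoint_path w (by fun_prop) ?_ ?_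
    (reTrace x + reTrace y - reTrace z) ?_
  · simpa [hw] using h
  · intro t ht
    have h1 := hx t ht
    have h2 := hy t ht
    have h3 := hz t ht
    rw [hw]
    simp only
    rw [← Unitary.norm_sub_eq]
    set E := expUnitary (t • x)
    set F := expUnitary (t • y)
    set G := expUnitary (t • z)
    have key : ((p * E * (q * F) : Matrix.unitaryGroup (Fin n) ℂ) : Matrix (Fin n) (Fin n) ℂ)
        - (p * q * G : Matrix.unitaryGroup (Fin n) ℂ)
        = p * ((E - 1 : Matrix (Fin n) (Fin n) ℂ) * (q * F : Matrix.unitaryGroup (Fin n) ℂ))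
          + (p * q : Matrix.unitaryGroup (Fin n) ℂ) * (F - 1 : Matrix (Fin n) (Fin n) ℂ)
          - (p * q : Matrix.unitaryGroup (Fin n) ℂ) * (G - 1 : Matrix (Fin n) (Fin n) ℂ) := by
      push_cast
      noncomm_ring
    rw [key]
    refine (norm_sub_le _ _).trans_lt ?_
    refine (add_le_add_left (norm_add_le _ _) _).trans_lt ?_
    rw [CStarRing.norm_coe_unitary_mul, CStarRing.norm_coe_unitary_mul,
      CStarRing.norm_coe_unitary_mul, CStarRing.norm_mul_coe_unitary]
    linarith
  · simp only [hw, zero_smul, expUnitary_zero, mul_one, Unitary.mul_star_self]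
  · intro t
    have hmul : w t * (p * q * expUnitary (t • z))
        = p * expUnitary (t • x) * (q * expUnitary (t • y)) := by
      simp only [hw]
      rw [mul_assoc, Unitary.star_mul_self, mul_one]
    have hd := congrArg (fun u : Matrix.unitaryGroup (Fin n) ℂ =>
      Matrix.det (u : Matrix (Fin n) (Fin n) ℂ)) hmul
    simp only [Submonoid.coe_mul, Matrix.det_mul, det_expUnitary, reTrace_smul] at hd
    have hd' : Matrix.det (w t : Matrix (Fin n) (Fin n) ℂ)
        * Complex.exp (Complex.I * ((t * reTrace z : ℝ) : ℂ))
        = Complex.exp (Complex.I * ((t * reTrace x : ℝ) : ℂ))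
          * Complex.exp (Complex.I * ((t * reTrace y : ℝ) : ℂ)) := by
      refine mul_left_cancel₀ (mul_ne_zero (hdetne p) (hdetne q)) ?_
      linear_combination hd
    refine mul_right_cancel₀ (Complex.exp_ne_zero (Complex.I * ((t * reTrace z : ℝ) : ℂ))) ?_
    rw [hd', ← Complex.exp_add, ← Complex.exp_add]
    congr 1
    push_cast
    ring

/-- If a map `φ` into a unitary group is uniformly close to a homomorphism `ψ` at `g`, `h` and
`g * h`, then the trace of the logarithm of its multiplicative defect at `(g, h)` is the
coboundary of `g ↦ Tr (log (ψ(g)⁻¹ φ(g)))`. -/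
lemma reTrace_argSelfAdjoint_eq_coboundary {Γ : Type*} [Group Γ]
    (φ : Γ → Matrix.unitaryGroup (Fin n) ℂ) (ψ : Γ →* Matrix.unitaryGroup (Fin n) ℂ) (g h : Γ)
    (hg : ‖(ψ g - φ g : Matrix (Fin n) (Fin n) ℂ)‖ < 1 / 2)
    (hh : ‖(ψ h - φ h : Matrix (Fin n) (Fin n) ℂ)‖ < 1 / 2)
    (hgh : ‖(ψ (g * h) - φ (g * h) : Matrix (Fin n) (Fin n) ℂ)‖ < 1 / 2) :
    reTrace (argSelfAdjoint (φ g * φ h * star (φ (g * h))))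
      = reTrace (argSelfAdjoint (star (ψ g) * φ g)) + reTrace (argSelfAdjoint (star (ψ h) * φ h))
        - reTrace (argSelfAdjoint (star (ψ (g * h)) * φ (g * h))) := by
  have hdist {k : Γ} (hk : ‖(ψ k - φ k : Matrix (Fin n) (Fin n) ℂ)‖ < 1 / 2) :
      ‖((star (ψ k) * φ k : Matrix.unitaryGroup (Fin n) ℂ) - 1 : Matrix (Fin n) (Fin n) ℂ)‖
        < 1 / 2 := by
    rw [← CStarRing.norm_coe_unitary_mul (ψ k), mul_sub, ← Submonoid.coe_mul, ← mul_assoc,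
      Unitary.mul_star_self, one_mul, mul_one, norm_sub_rev]
    exact hk
  have hexp {k : Γ} (hk : ‖(ψ k - φ k : Matrix (Fin n) (Fin n) ℂ)‖ < 1 / 2) :
      ψ k * expUnitary (argSelfAdjoint (star (ψ k) * φ k)) = φ k := by
    rw [expUnitary_argSelfAdjoint ((hdist hk).trans (by norm_num)), ← mul_assoc,
      Unitary.mul_star_self, one_mul]
  have hpath {k : Γ} (hk : ‖(ψ k - φ k : Matrix (Fin n) (Fin n) ℂ)‖ < 1 / 2) :
      ∀ t ∈ Set.Icc (0 : ℝ) 1,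
        ‖(expUnitary (t • argSelfAdjoint (star (ψ k) * φ k)) - 1 : Matrix (Fin n) (Fin n) ℂ)‖
          < 1 / 2 := fun t ht =>
    (Unitary.norm_expUnitary_smul_argSelfAdjoint_sub_one_le _ ht
      ((hdist hk).trans (by norm_num))).trans_lt (hdist hk)
  have key := reTrace_argSelfAdjoint_defect (ψ g) (ψ h) _ _ _ (hpath hg) (hpath hh) (hpath hgh)
  rwa [hexp hg, hexp hh, ← map_mul, hexp hgh] at key

end Determinant

section ClockShift

lemma zpow_mul_zpow_of_mul_eq {G : Type*} [Group G] {u v z : G} (h : u * v = z * (v * u))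
    (hu : Commute z u) (hv : Commute z v) (k l : ℤ) :
    u ^ k * v ^ l = z ^ (k * l) * (v ^ l * u ^ k) := by
  have h1 : u * v ^ l * u⁻¹ = z ^ l * v ^ l := by
    rw [← conj_zpow, h, ← hv.mul_zpow]
    group
  have h2 : (v ^ l)⁻¹ * u * v ^ l = z ^ l * u := by
    have h3 : u * v ^ l = z ^ l * v ^ l * u := by rw [← h1]; group
    rw [mul_assoc, h3, (hv.zpow_zpow l l).eq]
    group
  have h4 : (v ^ l)⁻¹ * u ^ k * v ^ l = z ^ (k * l) * u ^ k := by
    have := conj_zpow (i := k) (a := (v ^ l)⁻¹) (b := u)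
    rw [inv_inv] at this
    rw [← this, h2, (hu.zpow_left l).mul_zpow, ← zpow_mul, mul_comm l k]
  calc u ^ k * v ^ l = v ^ l * ((v ^ l)⁻¹ * u ^ k * v ^ l) := by group
    _ = z ^ (k * l) * (v ^ l * u ^ k) := by
      rw [h4, ← mul_assoc, ← (hv.zpow_zpow (k * l) l).eq, mul_assoc]

/-- The scalar unitary matrix `exp (i θ)`. -/
noncomputable def scalarUnitary (n : ℕ) (θ : ℝ) : Matrix.unitaryGroup (Fin n) ℂ :=
  expUnitary (θ • (1 : selfAdjoint (Matrix (Fin n) (Fin n) ℂ)))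

lemma coe_scalarUnitary (n : ℕ) (θ : ℝ) :
    (scalarUnitary n θ : Matrix (Fin n) (Fin n) ℂ) = Complex.exp (θ * Complex.I) • 1 := by
  have h := NormedSpace.algebraMap_exp_comm (𝔸 := Matrix (Fin n) (Fin n) ℂ)
    ((θ : ℂ) * Complex.I)
  rw [Algebra.algebraMap_eq_smul_one, Algebra.algebraMap_eq_smul_one, ← Complex.exp_eq_exp_ℂ] at h
  rw [h, scalarUnitary, expUnitary_coe]
  congr 1
  simp [mul_comm, mul_smul]

lemma commute_scalarUnitary (n : ℕ) (θ : ℝ) (u : Matrix.unitaryGroup (Fin n) ℂ) :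
    Commute (scalarUnitary n θ) u := by
  refine Subtype.ext ?_
  simp [coe_scalarUnitary]

lemma scalarUnitary_zpow (n : ℕ) (θ : ℝ) (k : ℤ) :
    scalarUnitary n θ ^ k = scalarUnitary n (k * θ) := by
  let f : Multiplicative ℝ →* Matrix.unitaryGroup (Fin n) ℂ :=
    { toFun := fun s => scalarUnitary n s.toAdd
      map_one' := by simp [scalarUnitary]
      map_mul' := fun s t => by
        refine Subtype.ext ?_
        simp only [toAdd_mul, Submonoid.coe_mul, coe_scalarUnitary, Complex.ofReal_add, add_mul,
          Complex.exp_add, mul_smul, smul_mul_assoc, one_mul] }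
  have h := map_zpow f (Multiplicative.ofAdd θ) k
  simpa [f, eq_comm] using h

lemma norm_scalarUnitary_sub_one_le (n : ℕ) (θ : ℝ) :
    ‖(scalarUnitary n θ - 1 : Matrix (Fin n) (Fin n) ℂ)‖ ≤ |θ| := by
  have h1 : ‖(1 : Matrix (Fin n) (Fin n) ℂ)‖ ≤ 1 := by
    simpa using Matrix.permMatrix_l2_opNorm_le (𝕜 := ℂ) (1 : Equiv.Perm (Fin n))
  have h2 : ‖Complex.exp (θ * Complex.I) - 1‖ ≤ |θ| := by
    simpa [mul_comm] using Real.norm_exp_I_mul_ofReal_sub_one_le (x := θ)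
  calc ‖(scalarUnitary n θ - 1 : Matrix (Fin n) (Fin n) ℂ)‖
      = ‖(Complex.exp (θ * Complex.I) - 1) • (1 : Matrix (Fin n) (Fin n) ℂ)‖ := by
        rw [coe_scalarUnitary, sub_smul, one_smul]
    _ ≤ ‖Complex.exp (θ * Complex.I) - 1‖ * ‖(1 : Matrix (Fin n) (Fin n) ℂ)‖ := norm_smul_le _ _
    _ ≤ |θ| * 1 := by gcongr
    _ = |θ| := mul_one _

lemma reTrace_argSelfAdjoint_scalarUnitary (n : ℕ) {θ : ℝ} (hθ : |θ| < Real.pi) :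
    reTrace (argSelfAdjoint (scalarUnitary n θ)) = n * θ := by
  have h1 : ‖(1 : Matrix (Fin n) (Fin n) ℂ)‖ ≤ 1 := by
    simpa using Matrix.permMatrix_l2_opNorm_le (𝕜 := ℂ) (1 : Equiv.Perm (Fin n))
  have hn : ‖θ • (1 : selfAdjoint (Matrix (Fin n) (Fin n) ℂ))‖ < Real.pi := by
    refine lt_of_le_of_lt ?_ hθ
    calc ‖θ • (1 : Matrix (Fin n) (Fin n) ℂ)‖ ≤ ‖θ‖ * ‖(1 : Matrix (Fin n) (Fin n) ℂ)‖ :=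
          norm_smul_le _ _
      _ ≤ |θ| * 1 := by rw [Real.norm_eq_abs]; gcongr
      _ = |θ| := mul_one _
  rw [scalarUnitary, argSelfAdjoint_expUnitary hn, reTrace_smul]
  simp [reTrace, mul_comm]

/-- The shift and clock matrices commute up to the scalar `exp (2 π i / n)`. -/
lemma exists_clock_shift (n : ℕ) :
    ∃ u v : Matrix.unitaryGroup (Fin n) ℂ,
      u * v = scalarUnitary n (2 * Real.pi / n) * (v * u) := by
  set c : Fin n → ℂ := fun i => Complex.exp ((i : ℂ) * (2 * Real.pi / n * Complex.I)) with hc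
  have hstar (i : Fin n) : c i * star (c i) = 1 := by
    simp only [hc, Complex.star_def, ← Complex.exp_conj, ← Complex.exp_add]
    simp [Complex.conj_ofNat]
  have hrot (i : Fin n) :
      c (finRotate n i) = Complex.exp (2 * Real.pi / n * Complex.I) * c i := by
    obtain _ | m := n
    · exact i.elim0
    simp only [hc, coe_finRotate, ← Complex.exp_add]
    split_ifs with hi
    · subst hi
      rw [Complex.exp_eq_exp_iff_exists_int]
      refine ⟨-1, ?_⟩
      have : ((m : ℂ) + 1) ≠ 0 := by exact_mod_cast m.succ_ne_zero
      push_cast [Fin.val_last]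
      field_simp
      ring
    · congr 1
      push_cast
      ring
  refine ⟨⟨(finRotate n).permMatrix ℂ, ?_⟩, ⟨Matrix.diagonal c, ?_⟩, Subtype.ext ?_⟩
  · rw [Matrix.mem_unitaryGroup_iff, Matrix.star_eq_conjTranspose,
      Matrix.conjTranspose_permMatrix, ← Matrix.permMatrix_mul, inv_mul_cancel,
      Matrix.permMatrix_one]
  · rw [Matrix.mem_unitaryGroup_iff, Matrix.star_eq_conjTranspose,
      Matrix.diagonal_conjTranspose, Matrix.diagonal_mul_diagonal, ← Matrix.diagonal_one]
    exact congrArg _ (funext hstar)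
  · simp only [Submonoid.coe_mul, coe_scalarUnitary]
    ext i j
    rw [Matrix.mul_diagonal, smul_mul_assoc, one_mul, Matrix.smul_apply, Matrix.diagonal_mul,
      Equiv.Perm.permMatrix, PEquiv.toMatrix_apply]
    generalize finRotate n = σ at hrot
    by_cases hij : σ i = j
    · subst hij
      simp [hrot]
    · simp [hij]

lemma l2OpNorm_sub_mul_le {n : ℕ} {p q r : Matrix.unitaryGroup (Fin n) ℂ} {θ : ℝ}
    (h : p * q = scalarUnitary n θ * r) :
    l2OpNorm ((r : Matrix (Fin n) (Fin n) ℂ)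
      - (p : Matrix (Fin n) (Fin n) ℂ) * (q : Matrix (Fin n) (Fin n) ℂ)) ≤ |θ| := by
  have h1 : (r - p * q : Matrix (Fin n) (Fin n) ℂ)
      = -((scalarUnitary n θ - 1 : Matrix (Fin n) (Fin n) ℂ) * r) := by
    rw [← Submonoid.coe_mul, h, Submonoid.coe_mul, sub_mul, one_mul, neg_sub]
  change ‖(r - p * q : Matrix (Fin n) (Fin n) ℂ)‖ ≤ |θ|
  rw [h1, norm_neg, CStarRing.norm_mul_coe_unitary]
  exact norm_scalarUnitary_sub_one_le n θ

/-- If a map `φ : Γ → U(n)` is multiplicative up to scalars `exp (i θ)`, then near a homomorphism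
the function `n θ` is a coboundary. -/
lemma exists_coboundary_of_near_hom {Γ : Type*} [Group Γ] {n : ℕ}
    (φ : Γ → Matrix.unitaryGroup (Fin n) ℂ) (ψ : Γ →* Matrix.unitaryGroup (Fin n) ℂ) :
    ∃ τ : Γ → ℝ, ∀ (g h : Γ) (θ : ℝ),
      l2OpNorm ((ψ g : Matrix (Fin n) (Fin n) ℂ) - (φ g : Matrix (Fin n) (Fin n) ℂ)) < 1 / 2 →
      l2OpNorm ((ψ h : Matrix (Fin n) (Fin n) ℂ) - (φ h : Matrix (Fin n) (Fin n) ℂ)) < 1 / 2 →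
      l2OpNorm ((ψ (g * h) : Matrix (Fin n) (Fin n) ℂ)
        - (φ (g * h) : Matrix (Fin n) (Fin n) ℂ)) < 1 / 2 →
      φ g * φ h = scalarUnitary n θ * φ (g * h) → |θ| < Real.pi →
      τ g - τ (g * h) + τ h = n * θ := by
  refine ⟨fun g => reTrace (argSelfAdjoint (star (ψ g) * φ g)), fun g h θ hg hh hgh hmul hθ => ?_⟩
  have key := reTrace_argSelfAdjoint_eq_coboundary φ ψ g h hg hh hgh
  rw [hmul, mul_assoc, Unitary.mul_star_self, mul_one,
    reTrace_argSelfAdjoint_scalarUnitary n hθ] at key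
  rw [key]
  ring

end ClockShift

end MatrixLogarithm

lemma IsTwoCycle.sum_mul_coboundary_eq_zero {Γ : Type*} [Group Γ] {N : ℕ} {x : Fin N → ℤ}
    {a b : Fin N → Γ} (hcycle : IsTwoCycle x a b) (τ : Γ → ℝ) :
    ∑ j : Fin N, (x j : ℝ) * (τ (a j) - τ (a j * b j) + τ (b j)) = 0 := by
  have h := congrArg (Finsupp.linearCombination ℤ τ) hcycle
  simpa [map_sum, Finsupp.linearCombination_single, mul_add, mul_sub] using h

/-- If `α, β : Γ → ℤ` are homomorphisms and the cocycle `(g,h) ↦ α(g)β(h)` pairs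
nontrivially with some 2-cycle, then `Γ` is not matricially stable: there is an
asymptotic homomorphism `φ_n : Γ → U(n)` in the operator norm that is not perturbable
to genuine representations in the operator norm. -/
theorem not_matricially_stable {Γ : Type*} [Group Γ] (α β : Γ → ℤ)
    (hα : ∀ g h : Γ, α (g * h) = α g + α h) (hβ : ∀ g h : Γ, β (g * h) = β g + β h)
    (N : ℕ) (x : Fin N → ℤ) (a b : Fin N → Γ) (hcycle : IsTwoCycle x a b)
    (hpair : ∑ j : Fin N, x j * (α (a j) * β (b j)) ≠ 0) :
    ∃ φ : ∀ n : ℕ, Γ → Matrix.unitaryGroup (Fin n) ℂ,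
      (∀ g h : Γ,
          Tendsto
            (fun n : ℕ =>
              l2OpNorm ((φ n (g * h) : Matrix (Fin n) (Fin n) ℂ) -
                (φ n g : Matrix (Fin n) (Fin n) ℂ) * (φ n h : Matrix (Fin n) (Fin n) ℂ)))
            atTop (nhds 0)) ∧
        ¬ ∃ ψ : ∀ n : ℕ, Γ →* Matrix.unitaryGroup (Fin n) ℂ,
            ∀ g : Γ,
              Tendsto
                (fun n : ℕ =>
                  l2OpNorm ((ψ n g : Matrix (Fin n) (Fin n) ℂ) -
                    (φ n g : Matrix (Fin n) (Fin n) ℂ)))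
                atTop (nhds 0) := by
  choose u v huv using exists_clock_shift
  set φ : ∀ n : ℕ, Γ → Matrix.unitaryGroup (Fin n) ℂ :=
    fun n g => v n ^ β g * u n ^ α g with hφ
  have hmul (n : ℕ) (g h : Γ) : φ n g * φ n h
      = scalarUnitary n ((α g * β h : ℤ) * (2 * Real.pi / n)) * φ n (g * h) := by
    have hc := commute_scalarUnitary n (2 * Real.pi / n)
    have h1 := zpow_mul_zpow_of_mul_eq (huv n) (hc _) (hc _) (α g) (β h)
    have h2 := (commute_scalarUnitary n ((α g * β h : ℤ) * (2 * Real.pi / n)) (v n ^ β g)).eq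
    rw [scalarUnitary_zpow] at h1
    simp only [hφ, hα, hβ, zpow_add]
    calc v n ^ β g * u n ^ α g * (v n ^ β h * u n ^ α h)
        = v n ^ β g * (u n ^ α g * v n ^ β h) * u n ^ α h := by group
      _ = _ := by
        rw [h1, ← mul_assoc (v n ^ β g), ← h2]
        simp only [mul_assoc]
  have htend (k : ℤ) : Tendsto (fun n : ℕ => |(k : ℝ) * (2 * Real.pi / n)|) atTop (nhds 0) := by
    have h := ((tendsto_const_div_atTop_nhds_zero_nat (2 * Real.pi)).const_mul (k : ℝ)).abs
    simpa using h
  refine ⟨φ, fun g h => ?_, ?_⟩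
  · refine squeeze_zero (fun n => norm_nonneg _) (fun n => ?_) (htend (α g * β h))
    exact l2OpNorm_sub_mul_le (hmul n g h)
  · rintro ⟨ψ, hψ⟩
    have hclose (g : Γ) := (hψ g).eventually_lt_const (show (0 : ℝ) < 1 / 2 by norm_num)
    have hev : ∀ᶠ n : ℕ in atTop, 0 < n ∧ ∀ j : Fin N,
        (l2OpNorm ((ψ n (a j) : Matrix (Fin n) (Fin n) ℂ) -
            (φ n (a j) : Matrix (Fin n) (Fin n) ℂ)) < 1 / 2 ∧
          l2OpNorm ((ψ n (b j) : Matrix (Fin n) (Fin n) ℂ) -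
            (φ n (b j) : Matrix (Fin n) (Fin n) ℂ)) < 1 / 2 ∧
          l2OpNorm ((ψ n (a j * b j) : Matrix (Fin n) (Fin n) ℂ) -
            (φ n (a j * b j) : Matrix (Fin n) (Fin n) ℂ)) < 1 / 2) ∧
        |((α (a j) * β (b j) : ℤ) : ℝ) * (2 * Real.pi / n)| < Real.pi :=
      (eventually_gt_atTop 0).and <| eventually_all.2 fun j =>
        ((hclose _).and ((hclose _).and (hclose _))).and
          ((htend _).eventually_lt_const Real.pi_pos)
    obtain ⟨n, hn, hj⟩ := hev.exists
    obtain ⟨τ, hτ⟩ := exists_coboundary_of_near_hom (φ n) (ψ n)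
    have hcob (j : Fin N) : τ (a j) - τ (a j * b j) + τ (b j)
        = 2 * Real.pi * ((α (a j) * β (b j) : ℤ) : ℝ) := by
      obtain ⟨⟨h1, h2, h3⟩, h4⟩ := hj j
      have hn' : (n : ℝ) ≠ 0 := by exact_mod_cast hn.ne'
      rw [hτ _ _ _ h1 h2 h3 (hmul n (a j) (b j)) h4]
      field_simp
    have hsum := hcycle.sum_mul_coboundary_eq_zero τ
    simp only [hcob] at hsum
    refine hpair ?_
    have hfactor : 2 * Real.pi * ((∑ j : Fin N, x j * (α (a j) * β (b j)) : ℤ) : ℝ) = 0 := by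
      rw [← hsum]
      push_cast
      rw [Finset.mul_sum]
      exact Finset.sum_congr rfl fun j _ => by ring
    exact_mod_cast (mul_eq_zero.1 hfactor).resolve_left (by positivity)
end
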